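/- (Norm concentration of sub-Gaussian vectors) Let X ∈ ℝⁿ be sub-Gaussian with variance proxy σ². Then for each δ ∈ (0,1) and ε ∈ (0,1), with ε₁ = 2 log(1+2/ε)/(1−ε)² and ε₂ = 2/(1−ε)², P( ‖X‖ ≤ √(σ²(ε₁ n + ε₂ log(1/δ))) ) ≥ 1 − δ. -/

import Mathlib

open MeasureTheory ProbabilityTheory Real
open scoped RealInnerProductSpace

/-- A random vector `X : Ω → ℝⁿ` is sub-Gaussian with variance proxy `σ2`:
`E X = 0` and `E exp(λ⟨ℓ,X⟩) ≤ exp(λ²σ2/2)` for all `λ ∈ ℝ` and unit vectors `ℓ`. -/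
def IsSubGaussian {Ω : Type*} [MeasurableSpace Ω] (μ : Measure Ω) {n : ℕ}
    (X : Ω → EuclideanSpace ℝ (Fin n)) (σ2 : ℝ) : Prop :=
  Integrable X μ ∧ (∫ ω, X ω ∂μ) = 0 ∧
    ∀ (lam : ℝ) (l : EuclideanSpace ℝ (Fin n)), ‖l‖ = 1 →
      Integrable (fun ω => Real.exp (lam * ⟪l, X ω⟫)) μ ∧
      (∫ ω, Real.exp (lam * ⟪l, X ω⟫) ∂μ) ≤ Real.exp (lam ^ 2 * σ2 / 2)

open Metric Module in
/-- Volume bound: an `ε`-separated subset of the unit ball of a finite-dimensional real normed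
space `E` has at most `(1 + 2 / ε) ^ dim E` points. -/
theorem card_le_of_pairwise_le_dist {E : Type*} [NormedAddCommGroup E] [NormedSpace ℝ E]
    [FiniteDimensional ℝ E] {ε : ℝ} (hε : 0 < ε) (s : Finset E) (hs : ∀ c ∈ s, ‖c‖ ≤ 1)
    (h : (s : Set E).Pairwise fun c d => ε ≤ dist c d) :
    (s.card : ℝ) ≤ (1 + 2 / ε) ^ finrank ℝ E := by
  borelize E
  let μ : Measure E := Measure.addHaar
  have hδ : 0 < ε / 2 := by positivity
  have hρ : 0 < 1 + ε / 2 := by positivity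
  have hdisj : (s : Set E).PairwiseDisjoint fun c => ball c (ε / 2) := fun c hc d hd hcd =>
    ball_disjoint_ball (by linarith [h hc hd hcd])
  have hsub : (⋃ c ∈ s, ball c (ε / 2)) ⊆ ball (0 : E) (1 + ε / 2) :=
    Set.iUnion₂_subset fun c hc => ball_subset_ball' (by
      rw [dist_zero_right]; linarith [hs c hc])
  have hvol := measure_mono (μ := μ) hsub
  rw [measure_biUnion_finset hdisj fun c _ => measurableSet_ball] at hvol
  simp only [μ.addHaar_ball_of_pos _ hδ, μ.addHaar_ball_of_pos _ hρ, Finset.sum_const,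
    nsmul_eq_mul, ← mul_assoc] at hvol
  have hcard := ENNReal.toReal_le_of_le_ofReal (by positivity)
    ((ENNReal.mul_le_mul_iff_left (measure_ball_pos _ _ zero_lt_one).ne'
      measure_ball_lt_top.ne).1 hvol)
  rw [ENNReal.toReal_mul, ENNReal.toReal_natCast, ENNReal.toReal_ofReal (by positivity),
    ← le_div_iff₀ (by positivity), ← div_pow] at hcard
  have hratio : 1 + 2 / ε = (1 + ε / 2) / (ε / 2) := by
    field_simp
    ring
  rwa [hratio]

open Metric Module in
/-- The unit sphere of a finite-dimensional real normed space `E` has an `ε`-net with at most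
`(1 + 2 / ε) ^ dim E` points. -/
theorem exists_finset_net_unitSphere (E : Type*) [NormedAddCommGroup E] [NormedSpace ℝ E]
    [FiniteDimensional ℝ E] {ε : ℝ} (hε : 0 < ε) :
    ∃ s : Finset E, (∀ l ∈ s, ‖l‖ = 1) ∧ (∀ x : E, ‖x‖ = 1 → ∃ l ∈ s, dist x l ≤ ε) ∧
      (s.card : ℝ) ≤ (1 + 2 / ε) ^ finrank ℝ E := by
  have := FiniteDimensional.proper ℝ E
  lift ε to NNReal using hε.le
  have hε' : ε / 2 ≠ 0 := by
    have : ε ≠ 0 := by rintro rfl; simp at hε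
    positivity
  obtain ⟨C, -, hCfin, hC⟩ := exists_finite_isCover_of_isCompact hε' (isCompact_sphere (0 : E) 1)
  have htop : packingNumber ε (sphere (0 : E) 1) ≠ ⊤ := by
    have hle := (packingNumber_two_mul_le_externalCoveringNumber (ε / 2) _).trans
      hC.externalCoveringNumber_le_encard
    rw [mul_div_cancel₀ _ (two_ne_zero)] at hle
    exact (hle.trans_lt hCfin.encard_lt_top).ne
  have hfin : (maximalSeparatedSet ε (sphere (0 : E) 1)).Finite := by
    rw [← Set.encard_ne_top_iff, encard_maximalSeparatedSet htop]
    exact htop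
  have hnorm : ∀ l ∈ hfin.toFinset, ‖l‖ = 1 := fun l hl => by
    simpa using maximalSeparatedSet_subset (hfin.mem_toFinset.1 hl)
  refine ⟨hfin.toFinset, hnorm, fun x hx => ?_,
    card_le_of_pairwise_le_dist hε _ (fun c hc => (hnorm c hc).le) ?_⟩
  · have hcov := isCover_iff_subset_iUnion_closedBall.1 (isCover_maximalSeparatedSet htop)
    simpa using hcov (show x ∈ sphere (0 : E) 1 by simpa using hx)
  · rw [hfin.coe_toFinset]
    intro c hc d hd hcd
    have hlt : (ε : ENNReal) < edist c d := isSeparated_maximalSeparatedSet hc hd hcd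
    rw [edist_nndist, ENNReal.coe_lt_coe] at hlt
    exact_mod_cast hlt.le

/-- Some point of an `ε`-net of the unit sphere almost achieves the norm of `x ≠ 0`. -/
theorem exists_mem_net_mul_norm_le_inner {E : Type*} [NormedAddCommGroup E]
    [InnerProductSpace ℝ E] {ε : ℝ} {s : Finset E}
    (hs : ∀ x : E, ‖x‖ = 1 → ∃ l ∈ s, dist x l ≤ ε) {x : E} (hx : x ≠ 0) :
    ∃ l ∈ s, (1 - ε) * ‖x‖ ≤ ⟪l, x⟫ := by
  have hx' : 0 < ‖x‖ := norm_pos_iff.2 hx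
  obtain ⟨l, hl, hd⟩ := hs (‖x‖⁻¹ • x) (by simp [norm_smul, hx'.ne'])
  refine ⟨l, hl, ?_⟩
  have hinner : ⟪‖x‖⁻¹ • x - l, x⟫ ≤ ε * ‖x‖ := by
    rw [dist_eq_norm] at hd
    exact (real_inner_le_norm _ _).trans (by gcongr)
  have hself : ⟪‖x‖⁻¹ • x, x⟫ = ‖x‖ := by
    rw [real_inner_smul_left, real_inner_self_eq_norm_sq]
    field_simp
  rw [inner_sub_left, hself] at hinner
  linarith

namespace IsSubGaussian

variable {Ω : Type*} [MeasurableSpace Ω] {μ : Measure Ω} [IsProbabilityMeasure μ] {n : ℕ}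
  {X : Ω → EuclideanSpace ℝ (Fin n)} {σ2 : ℝ}

/-- Chernoff bound for the one-dimensional marginals of a sub-Gaussian vector. -/
theorem measure_le_inner_le (hX : IsSubGaussian μ X σ2) (hσ : 0 < σ2) {s : ℝ} (hs : 0 ≤ s)
    {l : EuclideanSpace ℝ (Fin n)} (hl : ‖l‖ = 1) :
    μ.real {ω | s ≤ ⟪l, X ω⟫} ≤ exp (-(s ^ 2 / (2 * σ2))) := by
  obtain ⟨hint, hle⟩ := hX.2.2 (s / σ2) l hl
  refine (measure_ge_le_exp_mul_mgf s (by positivity) hint).trans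
    ((mul_le_mul_of_nonneg_left hle (exp_pos _).le).trans_eq ?_)
  rw [← exp_add]
  congr 1
  field_simp
  ring

/-- The marginals of a sub-Gaussian vector with nonpositive variance proxy vanish. -/
theorem inner_ae_eq_zero (hX : IsSubGaussian μ X σ2) (hσ : σ2 ≤ 0)
    {l : EuclideanSpace ℝ (Fin n)} (hl : ‖l‖ = 1) : ∀ᵐ ω ∂μ, ⟪l, X ω⟫ = 0 := by
  obtain ⟨hint₁, hle₁⟩ := hX.2.2 1 l hl
  obtain ⟨hint₂, hle₂⟩ := hX.2.2 (-1) l hl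
  have hone : ∀ a : ℝ, a ^ 2 = 1 → exp (a ^ 2 * σ2 / 2) ≤ 1 := fun a ha =>
    exp_le_one_iff.2 (by rw [ha]; linarith)
  have hpt : ∀ t : ℝ, 0 ≤ exp (1 * t) + exp (-1 * t) - 2 := fun t => by
    have := one_le_cosh t
    rw [cosh_eq] at this
    simp only [one_mul, neg_mul]
    linarith
  have hsum : Integrable (fun ω => exp (1 * ⟪l, X ω⟫) + exp (-1 * ⟪l, X ω⟫)) μ := hint₁.add hint₂
  have hzero : ∫ ω, (exp (1 * ⟪l, X ω⟫) + exp (-1 * ⟪l, X ω⟫) - 2) ∂μ = 0 := by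
    refine le_antisymm ?_ (integral_nonneg fun ω => hpt _)
    rw [integral_sub hsum (integrable_const _), integral_add hint₁ hint₂]
    simp only [integral_const, probReal_univ, one_smul]
    linarith [hone 1 (by norm_num), hone (-1) (by norm_num)]
  filter_upwards [(integral_eq_zero_iff_of_nonneg (fun ω => hpt _)
    (hsum.sub (integrable_const _))).1 hzero] with ω hω
  by_contra hne
  have hlt := one_lt_cosh.2 hne
  simp only [one_mul, neg_mul, Pi.zero_apply] at hω
  rw [cosh_eq] at hlt
  linarith

/-- A sub-Gaussian vector with nonpositive variance proxy vanishes almost surely. -/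
theorem ae_eq_zero (hX : IsSubGaussian μ X σ2) (hσ : σ2 ≤ 0) : ∀ᵐ ω ∂μ, X ω = 0 := by
  have hcoord : ∀ᵐ ω ∂μ, ∀ i : Fin n, ⟪EuclideanSpace.single i (1 : ℝ), X ω⟫ = 0 :=
    ae_all_iff.2 fun i => hX.inner_ae_eq_zero hσ (by simp)
  filter_upwards [hcoord] with ω hω
  ext i
  simpa [EuclideanSpace.inner_single_left] using hω i

/-- Tail bound for the norm of a sub-Gaussian vector, from a union bound over an `ε`-net. -/
theorem measure_lt_norm_le (hX : IsSubGaussian μ X σ2) (hσ : 0 < σ2) {ε r : ℝ} (hε : 0 < ε)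
    (hε1 : ε < 1) (hr : 0 ≤ r) :
    μ.real {ω | r < ‖X ω‖} ≤ (1 + 2 / ε) ^ n * exp (-(((1 - ε) * r) ^ 2 / (2 * σ2))) := by
  have hε' : 0 < 1 - ε := sub_pos.2 hε1
  obtain ⟨s, hs1, hnet, hcard⟩ := exists_finset_net_unitSphere (EuclideanSpace ℝ (Fin n)) hε
  rw [finrank_euclideanSpace_fin] at hcard
  have hsub : {ω | r < ‖X ω‖} ⊆ ⋃ l ∈ s, {ω | (1 - ε) * r ≤ ⟪l, X ω⟫} := fun ω hω => by
    have hω' : r < ‖X ω‖ := hω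
    obtain ⟨l, hl, hle⟩ := exists_mem_net_mul_norm_le_inner hnet
      (norm_pos_iff.1 (hr.trans_lt hω'))
    exact Set.mem_biUnion hl ((mul_le_mul_of_nonneg_left hω'.le hε'.le).trans hle)
  calc μ.real {ω | r < ‖X ω‖}
      ≤ ∑ l ∈ s, μ.real {ω | (1 - ε) * r ≤ ⟪l, X ω⟫} :=
        (measureReal_mono hsub (measure_ne_top _ _)).trans (measureReal_biUnion_finset_le _ _)
    _ ≤ ∑ _l ∈ s, exp (-(((1 - ε) * r) ^ 2 / (2 * σ2))) :=
        Finset.sum_le_sum fun l hl => hX.measure_le_inner_le hσ (by positivity) (hs1 l hl)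
    _ ≤ (1 + 2 / ε) ^ n * exp (-(((1 - ε) * r) ^ 2 / (2 * σ2))) := by
        rw [Finset.sum_const, nsmul_eq_mul]
        gcongr

end IsSubGaussian

/-- norm concentration of sub-Gaussian vectors: if `X` is
sub-Gaussian with variance proxy σ², then for all `δ, ε ∈ (0,1)`, with
`ε₁ = 2 log(1+2/ε)/(1-ε)²` and `ε₂ = 2/(1-ε)²`,
`P(‖X‖ ≤ √(σ²(ε₁ n + ε₂ log(1/δ)))) ≥ 1 - δ`. -/
theorem norm_concentration_subGaussian
    {Ω : Type*} [MeasurableSpace Ω] (μ : Measure Ω) [IsProbabilityMeasure μ]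
    {n : ℕ} (X : Ω → EuclideanSpace ℝ (Fin n)) (σ2 : ℝ)
    (hXm : Measurable X) (hX : IsSubGaussian μ X σ2) :
    ∀ δ ε : ℝ, 0 < δ → δ < 1 → 0 < ε → ε < 1 →
      ENNReal.ofReal (1 - δ) ≤
        μ {ω | ‖X ω‖ ≤ Real.sqrt (σ2 *
          ((2 * Real.log (1 + 2 / ε) / (1 - ε) ^ 2) * n +
            (2 / (1 - ε) ^ 2) * Real.log (1 / δ)))} := by
  intro δ ε hδ hδ1 hε hε1
  rcases le_or_gt σ2 0 with hσ | hσ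
  · have hae : ∀ᵐ ω ∂μ, ‖X ω‖ ≤ Real.sqrt (σ2 *
        ((2 * Real.log (1 + 2 / ε) / (1 - ε) ^ 2) * n +
          (2 / (1 - ε) ^ 2) * Real.log (1 / δ))) := by
      filter_upwards [hX.ae_eq_zero hσ] with ω hω
      rw [hω, norm_zero]
      exact Real.sqrt_nonneg _
    have hone := measure_congr (Filter.eventuallyEq_univ.2 hae)
    rw [measure_univ] at hone
    rw [hone]
    exact ENNReal.ofReal_le_one.2 (by linarith)
  set r := Real.sqrt (σ2 *
    ((2 * Real.log (1 + 2 / ε) / (1 - ε) ^ 2) * n +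
      (2 / (1 - ε) ^ 2) * Real.log (1 / δ))) with hr
  have hε' : 0 < 1 - ε := sub_pos.2 hε1
  have hlogε : 0 ≤ Real.log (1 + 2 / ε) := Real.log_nonneg (by linarith [div_pos two_pos hε])
  have hlogδ : 0 ≤ Real.log (1 / δ) := Real.log_nonneg ((one_le_div hδ).2 hδ1.le)
  have hexp : ((1 - ε) * r) ^ 2 / (2 * σ2) = n * Real.log (1 + 2 / ε) + Real.log (1 / δ) := by
    rw [mul_pow, hr, Real.sq_sqrt (by positivity)]
    field_simp
  have htail : μ.real {ω | r < ‖X ω‖} ≤ δ := by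
    refine (hX.measure_lt_norm_le hσ hε hε1 (Real.sqrt_nonneg _)).trans_eq ?_
    rw [hexp, neg_add, Real.exp_add, Real.exp_neg, Real.exp_nat_mul,
      Real.exp_log (by positivity), one_div, Real.log_inv, neg_neg, Real.exp_log hδ]
    field_simp
  have hmeas : MeasurableSet {ω | r < ‖X ω‖} := measurableSet_lt measurable_const hXm.norm
  have hcompl : {ω | ‖X ω‖ ≤ r} = {ω | r < ‖X ω‖}ᶜ := by
    ext ω
    simp
  rw [hcompl, ← ofReal_measureReal, probReal_compl_eq_one_sub hmeas]
  exact ENNReal.ofReal_le_ofReal (by linarith)
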